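/- arXiv:2212.04841 — 10 statements merged into one kernel-verified Lean document; each statement's English description precedes it below -/
import Mathlib

section
/- For every τ ∈ ℝ one has F̄_λ(τ) ≤ (p/(p+1))·|τ|^{(p+1)/p} and F̄_λ(τ) ≤ (r/(r+1))·λ^{−1/r}·|τ|^{(r+1)/r}. -/
open Real

/-- The primitive of an odd function bounded on `[0, ∞)` by `C s ^ q` is bounded by
`C / (q + 1) * |τ| ^ (q + 1)`. No integrability of `g` is needed. -/
lemma integral_le_of_odd_of_le_rpow {g : ℝ → ℝ} {C q : ℝ} (hq : 0 ≤ q)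
    (hodd : ∀ s, g (-s) = -g s) (hnonneg : ∀ s, 0 ≤ s → 0 ≤ g s)
    (hle : ∀ s, 0 ≤ s → g s ≤ C * s ^ q) (τ : ℝ) :
    ∫ s in (0 : ℝ)..τ, g s ≤ C / (q + 1) * |τ| ^ (q + 1) := by
  have of_nonneg : ∀ t, 0 ≤ t → ∫ s in (0 : ℝ)..t, g s ≤ C / (q + 1) * t ^ (q + 1) := by
    intro t ht
    have hint : IntervalIntegrable (fun s : ℝ => C * s ^ q) MeasureTheory.volume 0 t :=
      (intervalIntegral.intervalIntegrable_rpow' (by linarith)).const_mul C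
    have hval : ∫ s in (0 : ℝ)..t, C * s ^ q = C / (q + 1) * t ^ (q + 1) := by
      rw [intervalIntegral.integral_const_mul, integral_rpow (Or.inl (by linarith)),
        zero_rpow (by linarith)]
      ring
    rw [← hval, intervalIntegral.integral_of_le ht, intervalIntegral.integral_of_le ht]
    refine MeasureTheory.integral_mono_of_nonneg ?_ hint.1 ?_
    · filter_upwards [MeasureTheory.ae_restrict_mem measurableSet_Ioc] with s hs
      exact hnonneg s hs.1.le
    · filter_upwards [MeasureTheory.ae_restrict_mem measurableSet_Ioc] with s hs
      exact hle s hs.1.le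
  rcases le_total 0 τ with h | h
  · rw [abs_of_nonneg h]
    exact of_nonneg τ h
  · have heven : ∫ s in (0 : ℝ)..τ, g s = ∫ s in (0 : ℝ)..(-τ), g s := by
      have := intervalIntegral.integral_comp_neg (a := 0) (b := -τ) g
      simp only [hodd, intervalIntegral.integral_neg, neg_neg, neg_zero] at this
      rw [intervalIntegral.integral_symm]
      linarith
    rw [abs_of_nonpos h, heven]
    exact of_nonneg (-τ) (by linarith)

/-- For every `τ ∈ ℝ`, `F̄_λ(τ) ≤ (p/(p+1))·|τ|^{(p+1)/p}` and
`F̄_λ(τ) ≤ (r/(r+1))·λ^{−1/r}·|τ|^{(r+1)/r}`. -/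
theorem stmt_2 (lam r p : ℝ) (hlam : 0 < lam) (hr : 0 < r) (hrp : r < p)
    (f finv Fbar : ℝ → ℝ)
    (hf : ∀ t : ℝ, f t = lam * |t| ^ (r - 1) * t + |t| ^ (p - 1) * t)
    (hinv₁ : ∀ t : ℝ, f (finv t) = t) (hinv₂ : ∀ t : ℝ, finv (f t) = t)
    (hF : ∀ t : ℝ, Fbar t = ∫ s in (0:ℝ)..t, finv s) :
    ∀ τ : ℝ,
      Fbar τ ≤ p / (p + 1) * |τ| ^ ((p + 1) / p) ∧
      Fbar τ ≤ r / (r + 1) * lam ^ (-(1 / r)) * |τ| ^ ((r + 1) / r) := by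
  have hp : 0 < p := hr.trans hrp
  have hodd : ∀ s, finv (-s) = -finv s := by
    intro s
    have h : f (-finv s) = -s := by
      rw [← hinv₁ s, hinv₂, hf, hf, abs_neg]
      ring
    rw [← h, hinv₂]
  have hnonneg : ∀ s, 0 ≤ s → 0 ≤ finv s := by
    intro s hs
    by_contra! hneg
    have h := hinv₁ s
    have habs : 0 < |finv s| := abs_pos.mpr hneg.ne
    rw [hf, ← add_mul] at h
    have : (lam * |finv s| ^ (r - 1) + |finv s| ^ (p - 1)) * finv s < 0 :=
      mul_neg_of_pos_of_neg (by positivity) hneg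
    linarith
  have hsum : ∀ s, 0 ≤ s → lam * finv s ^ r + finv s ^ p = s := by
    intro s hs
    rcases (hnonneg s hs).eq_or_lt with h0 | hpos
    · have h := hinv₁ s
      rw [hf, ← h0] at h
      rw [← h0, zero_rpow hr.ne', zero_rpow hp.ne']
      simpa using h
    · have h := hinv₁ s
      rw [hf, abs_of_pos hpos, mul_assoc, rpow_sub_one hpos.ne', rpow_sub_one hpos.ne',
        div_mul_cancel₀ _ hpos.ne', div_mul_cancel₀ _ hpos.ne'] at h
      exact h
  have hle_p : ∀ s, 0 ≤ s → finv s ≤ 1 * s ^ (1 / p) := by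
    intro s hs
    have hx := hnonneg s hs
    have hpow : finv s ^ p ≤ s := by
      have : 0 ≤ lam * finv s ^ r := by positivity
      linarith [hsum s hs]
    rw [one_mul, one_div]
    exact (le_rpow_inv_iff_of_pos hx hs hp).mpr hpow
  have hle_r : ∀ s, 0 ≤ s → finv s ≤ lam ^ (-(1 / r)) * s ^ (1 / r) := by
    intro s hs
    have hx := hnonneg s hs
    have hpow : finv s ^ r ≤ s / lam := by
      have : 0 ≤ finv s ^ p := by positivity
      rw [le_div_iff₀ hlam]
      linarith [hsum s hs]
    have h := (le_rpow_inv_iff_of_pos hx (by positivity) hr).mpr hpow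
    rwa [div_rpow hs hlam.le, div_eq_inv_mul, ← rpow_neg hlam.le, ← one_div] at h
  intro τ
  rw [hF]
  constructor
  · convert integral_le_of_odd_of_le_rpow (by positivity) hodd hnonneg hle_p τ using 2
    · field_simp
      ring
    · congr 1
      field_simp
      ring
  · convert integral_le_of_odd_of_le_rpow (by positivity) hodd hnonneg hle_r τ using 2
    · field_simp
      ring
    · congr 1
      field_simp
      ring
end

section
/- Let s > 0 satisfy rs ≥ 1. Then for every t ∈ ℝ one has F̄_λ(t) ≥ f_λ^{−1}(t)·t/(s+1). -/
open Real

/-- For `s > 0`, the average of `u ↦ (u / t) ^ s` over `[0, t]` is `1 / (s + 1)`. -/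
lemma integral_div_rpow {s t : ℝ} (hs : 0 < s) (ht : 0 < t) :
    ∫ u in (0:ℝ)..t, (u / t) ^ s = t / (s + 1) := by
  rw [intervalIntegral.integral_comp_div (fun x => x ^ s) ht.ne', zero_div, div_self ht.ne',
    integral_rpow (Or.inl (by linarith)), one_rpow, zero_rpow (by linarith), smul_eq_mul]
  ring

/-- A monotone `g` with `(u / t) ^ s * g t ≤ g u` on `[0, t]` satisfies the integrated bound. -/
lemma Monotone.mul_div_le_integral {g : ℝ → ℝ} (hg : Monotone g) {s t : ℝ} (hs : 0 < s)
    (ht : 0 < t) (h : ∀ u ∈ Set.Icc 0 t, (u / t) ^ s * g t ≤ g u) :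
    g t * t / (s + 1) ≤ ∫ u in (0:ℝ)..t, g u := by
  have hc : Continuous fun u : ℝ => (u / t) ^ s * g t :=
    ((continuous_id.div_const t).rpow_const fun _ => Or.inr hs.le).mul_const _
  calc g t * t / (s + 1) = ∫ u in (0:ℝ)..t, (u / t) ^ s * g t := by
        rw [intervalIntegral.integral_mul_const, integral_div_rpow hs ht]; ring
    _ ≤ _ := intervalIntegral.integral_mono_on ht.le (hc.intervalIntegrable _ _)
        hg.intervalIntegrable h

lemma abs_rpow_sub_one_mul_self {a x : ℝ} (ha : 0 < a) (hx : 0 ≤ x) :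
    |x| ^ (a - 1) * x = x ^ a := by
  rw [abs_of_nonneg hx]
  nth_rw 2 [← rpow_one x]
  rw [← rpow_add' hx (by linarith), sub_add_cancel]

/-- For `s > 0` with `rs ≥ 1`, `F̄_λ(t) ≥ f_λ^{−1}(t)·t/(s+1)` for all `t`. -/
theorem stmt_6 (lam r p s : ℝ) (hlam : 0 < lam) (hr : 0 < r) (hrp : r < p)
    (hs : 0 < s) (hrs : 1 ≤ r * s)
    (f finv Fbar : ℝ → ℝ)
    (hf : ∀ t : ℝ, f t = lam * |t| ^ (r - 1) * t + |t| ^ (p - 1) * t)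
    (hinv₁ : ∀ t : ℝ, f (finv t) = t) (hinv₂ : ∀ t : ℝ, finv (f t) = t)
    (hF : ∀ t : ℝ, Fbar t = ∫ u in (0:ℝ)..t, finv u) :
    ∀ t : ℝ, Fbar t ≥ finv t * t / (s + 1) := by
  have hp : 0 < p := hr.trans hrp
  have hf_nonneg : ∀ x, 0 ≤ x → f x = lam * x ^ r + x ^ p := fun x hx => by
    rw [hf, mul_assoc, abs_rpow_sub_one_mul_self hr hx, abs_rpow_sub_one_mul_self hp hx]
  have hf_odd : ∀ x, f (-x) = -f x := fun x => by simp only [hf, abs_neg]; ring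
  have hf_mono : StrictMono f := by
    refine strictMono_of_odd_strictMonoOn_nonneg hf_odd fun x hx y hy hxy => ?_
    rw [hf_nonneg x hx, hf_nonneg y hy]
    have h₁ := rpow_lt_rpow hx hxy hr
    have h₂ := rpow_lt_rpow hx hxy hp
    gcongr
  have hfinv_mono : Monotone finv := fun x y hxy => by
    rwa [← hf_mono.le_iff_le, hinv₁, hinv₁]
  have hfinv_odd : ∀ x, finv (-x) = -finv x := fun x => by
    rw [← hinv₂ (-finv x), hf_odd, hinv₁]
  have hfinv_zero : finv 0 = 0 := by simpa [hf] using hinv₂ 0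
  have hf_scale : ∀ c x, 0 ≤ c → c ≤ 1 → 0 ≤ x → f (c ^ s * x) ≤ c * f x := by
    intro c x hc hc1 hx
    have hcs : 0 ≤ c ^ s := rpow_nonneg hc s
    have hpow : ∀ a, r ≤ a → (c ^ s * x) ^ a ≤ c * x ^ a := fun a ha => by
      rw [mul_rpow hcs hx, ← rpow_mul hc]
      refine mul_le_mul_of_nonneg_right ?_ (rpow_nonneg hx a)
      exact rpow_le_self_of_le_one hc hc1 (by nlinarith)
    rw [hf_nonneg _ (mul_nonneg hcs hx), hf_nonneg x hx]
    nlinarith [mul_le_mul_of_nonneg_left (hpow r le_rfl) hlam.le, hpow p hrp.le]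
  have hpos : ∀ t, 0 < t → finv t * t / (s + 1) ≤ ∫ u in (0:ℝ)..t, finv u := by
    intro t ht
    refine hfinv_mono.mul_div_le_integral hs ht fun u hu => ?_
    have hx : 0 ≤ finv t := hfinv_zero ▸ hfinv_mono ht.le
    rw [← hf_mono.le_iff_le, hinv₁]
    refine (hf_scale (u / t) _ (div_nonneg hu.1 ht.le) ((div_le_one ht).2 hu.2) hx).trans_eq ?_
    rw [hinv₁, div_mul_cancel₀ _ ht.ne']
  intro t
  rw [hF, ge_iff_le]
  rcases lt_trichotomy t 0 with ht | rfl | ht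
  · have h := hpos (-t) (neg_pos.2 ht)
    have hint : ∫ u in (0:ℝ)..(-t), finv u = ∫ u in (0:ℝ)..t, finv u := by
      have h' := intervalIntegral.integral_comp_neg (a := 0) (b := t) finv
      simp only [hfinv_odd, intervalIntegral.integral_neg, neg_zero] at h'
      rw [intervalIntegral.integral_symm, ← h', neg_neg]
    rwa [hint, hfinv_odd, neg_mul_neg] at h
  · simp
  · exact hpos t ht
end

section
/- For every t ∈ ℝ with |t| ≤ 2λ^{p/(p−r)} one has F̄_λ(t) ≥ (r/(r+1))·λ^{−1/r}·(|t|/2)^{(r+1)/r} + (p/(p+1))·(|t|/(2λ))^{(p+1)/r}, and for every t ∈ ℝ with |t| ≥ 2λ^{p/(p−r)} one has F̄_λ(t) ≥ (r/(r+1))·λ·(|t|/2)^{(r+1)/p} + (p/(p+1))·(|t|/2)^{(p+1)/p}. -/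
open Real

section PowerSum

variable {lam r p : ℝ} {f finv : ℝ → ℝ}

lemma eq_rpow_add_rpow_of_nonneg (hr : 0 < r) (hp : 0 < p)
    (hf : ∀ t : ℝ, f t = lam * |t| ^ (r - 1) * t + |t| ^ (p - 1) * t) {s : ℝ} (hs : 0 ≤ s) :
    f s = lam * s ^ r + s ^ p := by
  rw [hf, abs_of_nonneg hs]
  rcases hs.eq_or_lt with rfl | hs
  · simp [zero_rpow hr.ne', zero_rpow hp.ne']
  · rw [rpow_sub_one hs.ne', rpow_sub_one hs.ne']
    field_simp

lemma odd_of_eq (hf : ∀ t : ℝ, f t = lam * |t| ^ (r - 1) * t + |t| ^ (p - 1) * t) (t : ℝ) :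
    f (-t) = -f t := by
  rw [hf, hf, abs_neg]
  ring

lemma strictMono_of_eq (hlam : 0 < lam) (hr : 0 < r) (hp : 0 < p)
    (hf : ∀ t : ℝ, f t = lam * |t| ^ (r - 1) * t + |t| ^ (p - 1) * t) : StrictMono f := by
  refine strictMono_of_odd_strictMonoOn_nonneg (odd_of_eq hf) fun a ha b hb hab => ?_
  rw [Set.mem_Ici] at ha hb
  rw [eq_rpow_add_rpow_of_nonneg hr hp hf ha, eq_rpow_add_rpow_of_nonneg hr hp hf hb]
  have h₁ := rpow_lt_rpow ha hab hr
  have h₂ := rpow_lt_rpow ha hab hp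
  gcongr

lemma strictMono_inverse (hmono : StrictMono f) (hinv : ∀ t, f (finv t) = t) :
    StrictMono finv := fun a b hab => by
  rwa [← hmono.lt_iff_lt, hinv, hinv]

lemma continuous_inverse (hmono : StrictMono f) (hinv₁ : ∀ t, f (finv t) = t)
    (hinv₂ : ∀ t, finv (f t) = t) : Continuous finv :=
  (strictMono_inverse hmono hinv₁).monotone.continuous_of_surjective fun t => ⟨f t, hinv₂ t⟩

/-- The primitive of the inverse, evaluated at `f s`, is the Legendre transform of the primitive
of `f`. -/
lemma integral_inverse_eq (hlam : 0 < lam) (hr : 0 < r) (hp : 0 < p)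
    (hf : ∀ t : ℝ, f t = lam * |t| ^ (r - 1) * t + |t| ^ (p - 1) * t)
    (hinv₁ : ∀ t : ℝ, f (finv t) = t) (hinv₂ : ∀ t : ℝ, finv (f t) = t) {s : ℝ} (hs : 0 ≤ s) :
    ∫ u in (0:ℝ)..f s, finv u =
      r / (r + 1) * lam * s ^ (r + 1) + p / (p + 1) * s ^ (p + 1) := by
  rcases hs.eq_or_lt with rfl | hs
  · have h₀ : f 0 = 0 := by simp [hf]
    simp [h₀, zero_rpow (by positivity : r + 1 ≠ 0), zero_rpow (by positivity : p + 1 ≠ 0)]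
  set g : ℝ → ℝ := fun x => lam * x ^ r + x ^ p
  have hfg : ∀ x, 0 ≤ x → f x = g x := fun x hx => eq_rpow_add_rpow_of_nonneg hr hp hf hx
  have hg : Continuous g := (continuous_const.mul (continuous_rpow_const hr.le)).add
    (continuous_rpow_const hp.le)
  have hfinv := continuous_inverse (strictMono_of_eq hlam hr hp hf) hinv₁ hinv₂
  have hI (x : ℝ) : HasDerivAt (fun t => ∫ u in (0:ℝ)..t, finv u) (finv x) x :=
    (hfinv.integral_hasStrictDerivAt 0 x).hasDerivAt
  set H : ℝ → ℝ := fun x => (∫ u in (0:ℝ)..g x, finv u) -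
    (r / (r + 1) * lam * x ^ (r + 1) + p / (p + 1) * x ^ (p + 1))
  have hHcont : Continuous H := by
    refine .sub ((continuous_iff_continuousAt.2 fun x => (hI x).continuousAt).comp hg) (.add ?_ ?_)
    · exact continuous_const.mul (continuous_rpow_const (by positivity))
    · exact continuous_const.mul (continuous_rpow_const (by positivity))
  have hHderiv (x : ℝ) (hx : x ∈ Set.Ioo 0 s) : HasDerivAt H 0 x := by
    have hpow (q : ℝ) := hasDerivAt_rpow_const (p := q) (Or.inl hx.1.ne')
    have hg' := ((hpow r).const_mul lam).add (hpow p)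
    have h := ((hI (g x)).comp x hg').sub
      (((hpow (r + 1)).const_mul (r / (r + 1) * lam)).add
        ((hpow (p + 1)).const_mul (p / (p + 1))))
    refine h.congr_deriv ?_
    rw [← hfg x hx.1.le, hinv₂, add_sub_cancel_right, add_sub_cancel_right,
      rpow_sub_one hx.1.ne', rpow_sub_one hx.1.ne']
    have := hx.1.ne'
    field_simp
    ring
  obtain ⟨c, -, hc⟩ := exists_hasDerivAt_eq_slope H (fun _ => 0) hs hHcont.continuousOn hHderiv
  have hH₀ : H 0 = 0 := by
    simp [H, g, zero_rpow hr.ne', zero_rpow hp.ne', zero_rpow (by positivity : r + 1 ≠ 0),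
      zero_rpow (by positivity : p + 1 ≠ 0)]
  have hHs : H s = 0 := by
    rw [hH₀, eq_div_iff (by linarith)] at hc
    linarith
  rw [hfg s hs.le]
  exact sub_eq_zero.1 hHs

lemma integral_inverse_abs (hodd : ∀ t, finv (-t) = -finv t) (t : ℝ) :
    ∫ u in (0:ℝ)..|t|, finv u = ∫ u in (0:ℝ)..t, finv u := by
  rcases abs_choice t with h | h <;> rw [h]
  have := intervalIntegral.integral_comp_neg (a := 0) (b := t) finv
  simp only [hodd, intervalIntegral.integral_neg, neg_zero] at this
  rw [intervalIntegral.integral_symm, ← this, neg_neg]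

/-- A lower bound `s` for `finv |t|` yields a lower bound for the primitive of `finv` at `t`. -/
lemma le_integral_inverse (hlam : 0 < lam) (hr : 0 < r) (hp : 0 < p)
    (hf : ∀ t : ℝ, f t = lam * |t| ^ (r - 1) * t + |t| ^ (p - 1) * t)
    (hinv₁ : ∀ t : ℝ, f (finv t) = t) (hinv₂ : ∀ t : ℝ, finv (f t) = t) {s t : ℝ} (hs : 0 ≤ s)
    (hst : lam * s ^ r + s ^ p ≤ |t|) :
    r / (r + 1) * lam * s ^ (r + 1) + p / (p + 1) * s ^ (p + 1) ≤ ∫ u in (0:ℝ)..t, finv u := by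
  have hmono := strictMono_of_eq hlam hr hp hf
  have hodd (u : ℝ) : finv (-u) = -finv u := by
    apply hmono.injective
    rw [odd_of_eq hf, hinv₁, hinv₁]
  have hle : s ≤ finv |t| := by
    rwa [← hmono.le_iff_le, hinv₁, eq_rpow_add_rpow_of_nonneg hr hp hf hs]
  have h := integral_inverse_eq hlam hr hp hf hinv₁ hinv₂ (hs.trans hle)
  rw [hinv₁, integral_inverse_abs hodd] at h
  rw [h]
  gcongr

end PowerSum

lemma div_rpow_div_le {lam r p x : ℝ} (hlam : 0 < lam) (hr : 0 < r) (hrp : r < p) (hx : 0 ≤ x)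
    (h : x ≤ lam ^ (p / (p - r))) : (x / lam) ^ (p / r) ≤ x := by
  have hpr : 0 < p - r := sub_pos.2 hrp
  have hp : 0 < p := hr.trans hrp
  rcases hx.eq_or_lt with rfl | hx
  · simp [zero_rpow (by positivity : p / r ≠ 0)]
  have h' : x ^ ((p - r) / r) ≤ lam ^ (p / r) := by
    calc x ^ ((p - r) / r) ≤ (lam ^ (p / (p - r))) ^ ((p - r) / r) := by gcongr
      _ = lam ^ (p / r) := by
        rw [← rpow_mul hlam.le]
        congr 1
        field_simp
  rw [div_rpow hx.le hlam.le, div_le_iff₀ (by positivity)]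
  calc x ^ (p / r) = x * x ^ ((p - r) / r) := by
        rw [← rpow_one_add' hx.le (by positivity)]
        congr 1
        field_simp
        ring
    _ ≤ x * lam ^ (p / r) := by gcongr

lemma mul_rpow_div_le {lam r p x : ℝ} (hlam : 0 < lam) (hr : 0 < r) (hrp : r < p)
    (h : lam ^ (p / (p - r)) ≤ x) : lam * x ^ (r / p) ≤ x := by
  have hpr : 0 < p - r := sub_pos.2 hrp
  have hp : 0 < p := hr.trans hrp
  have hx : 0 < x := (by positivity : 0 < lam ^ (p / (p - r))).trans_le h
  have h' : lam ≤ x ^ ((p - r) / p) := by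
    calc lam = (lam ^ (p / (p - r))) ^ ((p - r) / p) := by
          rw [← rpow_mul hlam.le, div_mul_div_cancel₀ hpr.ne', div_self hp.ne', rpow_one]
      _ ≤ x ^ ((p - r) / p) := by gcongr
  calc lam * x ^ (r / p) ≤ x ^ ((p - r) / p) * x ^ (r / p) := by gcongr
    _ = x := by
      rw [← rpow_add hx, ← add_div, sub_add_cancel, div_self hp.ne', rpow_one]

/-- Lower bounds for `F̄_λ`:
for `|t| ≤ 2λ^{p/(p−r)}`,
`F̄_λ(t) ≥ (r/(r+1))·λ^{−1/r}·(|t|/2)^{(r+1)/r} + (p/(p+1))·(|t|/(2λ))^{(p+1)/r}`, and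
for `|t| ≥ 2λ^{p/(p−r)}`,
`F̄_λ(t) ≥ (r/(r+1))·λ·(|t|/2)^{(r+1)/p} + (p/(p+1))·(|t|/2)^{(p+1)/p}`. -/
theorem stmt_8 (lam r p : ℝ) (hlam : 0 < lam) (hr : 0 < r) (hrp : r < p)
    (f finv Fbar : ℝ → ℝ)
    (hf : ∀ t : ℝ, f t = lam * |t| ^ (r - 1) * t + |t| ^ (p - 1) * t)
    (hinv₁ : ∀ t : ℝ, f (finv t) = t) (hinv₂ : ∀ t : ℝ, finv (f t) = t)
    (hF : ∀ t : ℝ, Fbar t = ∫ u in (0:ℝ)..t, finv u) :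
    (∀ t : ℝ, |t| ≤ 2 * lam ^ (p / (p - r)) →
      Fbar t ≥ r / (r + 1) * lam ^ (-(1 / r)) * (|t| / 2) ^ ((r + 1) / r)
        + p / (p + 1) * (|t| / (2 * lam)) ^ ((p + 1) / r)) ∧
    (∀ t : ℝ, 2 * lam ^ (p / (p - r)) ≤ |t| →
      Fbar t ≥ r / (r + 1) * lam * (|t| / 2) ^ ((r + 1) / p)
        + p / (p + 1) * (|t| / 2) ^ ((p + 1) / p)) := by
  have hp : 0 < p := hr.trans hrp
  have hpow {a b c : ℝ} (ha : 0 ≤ a) : (a ^ (1 / b)) ^ c = a ^ (c / b) := by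
    rw [← rpow_mul ha, one_div_mul_eq_div]
  refine ⟨fun t ht => ?_, fun t ht => ?_⟩ <;> rw [hF, ge_iff_le]
  · have hx : 0 ≤ |t| / 2 := by positivity
    have hxl : 0 ≤ |t| / 2 / lam := by positivity
    have hle := div_rpow_div_le hlam hr hrp hx (by linarith)
    have h := le_integral_inverse (s := (|t| / 2 / lam) ^ (1 / r)) (t := t)
      hlam hr hp hf hinv₁ hinv₂ (by positivity) (by
        rw [hpow hxl, hpow hxl, div_self hr.ne', rpow_one, mul_div_cancel₀ _ hlam.ne']
        linarith)
    rw [hpow hxl, hpow hxl] at h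
    have hc : lam * (|t| / 2 / lam) ^ ((r + 1) / r) =
        lam ^ (-(1 / r)) * (|t| / 2) ^ ((r + 1) / r) := by
      have he : (r + 1) / r = 1 + 1 / r := by field_simp
      rw [div_rpow hx hlam.le, rpow_neg hlam.le, he, rpow_one_add' hlam.le (by positivity)]
      field_simp
    rwa [mul_assoc, hc, ← mul_assoc, div_div] at h
  · have hx : 0 ≤ |t| / 2 := by positivity
    have hle := mul_rpow_div_le hlam hr hrp (x := |t| / 2) (by linarith)
    have h := le_integral_inverse (s := (|t| / 2) ^ (1 / p)) (t := t)
      hlam hr hp hf hinv₁ hinv₂ (by positivity) (by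
        rw [hpow hx, hpow hx, div_self hp.ne', rpow_one]
        linarith)
    rwa [hpow hx, hpow hx] at h
end

section
/- Let s > 0 satisfy rs ≥ 1, and set τ = (ps − 1)/(2^{(p+1)/p}·(p+1)·(s+1)). Then for every t ∈ ℝ with |t| ≥ 2λ^{p/(p−r)} one has F̄_λ(t) − f_λ^{−1}(t)·t/(s+1) ≥ τ·|t|^{(p+1)/p}. -/
open Real

/-- The nonlinearity `t ↦ λ|t|^{r-1}t + |t|^{p-1}t` is `λ t^r + t^p` for nonnegative `t`. -/
theorem signed_power_sum_of_nonneg {lam r p x : ℝ} (hr : 0 < r) (hp : 0 < p) (hx : 0 ≤ x) :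
    lam * |x| ^ (r - 1) * x + |x| ^ (p - 1) * x = lam * x ^ r + x ^ p := by
  rcases hx.eq_or_lt with rfl | hx
  · simp [zero_rpow hr.ne', zero_rpow hp.ne']
  · rw [abs_of_pos hx, mul_assoc, ← rpow_add_one hx.ne', ← rpow_add_one hx.ne',
      sub_add_cancel, sub_add_cancel]

theorem strictMonoOn_power_sum {lam r p : ℝ} (hlam : 0 < lam) (hr : 0 < r) (hp : 0 < p) :
    StrictMonoOn (fun x : ℝ => lam * x ^ r + x ^ p) (Set.Ici 0) := by
  intro x hx y _ hxy
  have h1 : x ^ r < y ^ r := rpow_lt_rpow hx hxy hr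
  have h2 : x ^ p < y ^ p := rpow_lt_rpow hx hxy hp
  have h3 := mul_lt_mul_of_pos_left h1 hlam
  simp only
  linarith

/-- The primitive of the inverse of `x ↦ λ x^r + x^p`, evaluated by substitution. -/
theorem integral_inverse_power_sum {lam r p v : ℝ} (hr : 0 < r) (hp : 0 < p) (hv : 0 ≤ v)
    {g : ℝ → ℝ} (hg : Continuous g) (hginv : ∀ x : ℝ, 0 ≤ x → g (lam * x ^ r + x ^ p) = x) :
    ∫ u in (0 : ℝ)..(lam * v ^ r + v ^ p), g u =
      lam * r / (r + 1) * v ^ (r + 1) + p / (p + 1) * v ^ (p + 1) := by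
  have hder : ∀ x : ℝ, 0 < x → HasDerivAt (fun x : ℝ => lam * x ^ r + x ^ p)
      (lam * (r * x ^ (r - 1)) + p * x ^ (p - 1)) x := fun x hx =>
    ((hasDerivAt_rpow_const (Or.inl hx.ne')).const_mul lam).add
      (hasDerivAt_rpow_const (Or.inl hx.ne'))
  have hcont : Continuous (fun x : ℝ => lam * x ^ r + x ^ p) :=
    ((continuous_rpow_const hr.le).const_mul lam).add (continuous_rpow_const hp.le)
  have hcont' : Continuous (fun x : ℝ => lam * r * x ^ r + p * x ^ p) :=
    ((continuous_rpow_const hr.le).const_mul _).add ((continuous_rpow_const hp.le).const_mul _)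
  have hpw : ∀ x : ℝ, 0 < x →
      g (lam * x ^ r + x ^ p) * (lam * (r * x ^ (r - 1)) + p * x ^ (p - 1)) =
        lam * r * x ^ r + p * x ^ p := by
    intro x hx
    rw [hginv x hx.le, rpow_sub_one hx.ne', rpow_sub_one hx.ne']
    field_simp
  have hsub := intervalIntegral.integral_comp_mul_deriv''' (a := 0) (b := v) (g := g)
    (f := fun x : ℝ => lam * x ^ r + x ^ p)
    (f' := fun x : ℝ => lam * (r * x ^ (r - 1)) + p * x ^ (p - 1))
    hcont.continuousOn
    (fun x hx => (hder x (by simpa [hv] using hx.1)).hasDerivWithinAt)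
    hg.continuousOn
    ((hg.continuousOn).integrableOn_compact (isCompact_uIcc.image hcont))
    (by
      rw [Set.uIcc_of_le hv, integrableOn_Icc_iff_integrableOn_Ioc]
      refine (hcont'.integrableOn_Ioc).congr_fun (fun x hx => ?_) measurableSet_Ioc
      exact (hpw x hx.1).symm)
  have h0 : lam * (0 : ℝ) ^ r + 0 ^ p = 0 := by simp [zero_rpow hr.ne', zero_rpow hp.ne']
  simp only [h0, Function.comp_apply] at hsub
  rw [← hsub, intervalIntegral.integral_congr_ae (g := fun x : ℝ => lam * r * x ^ r + p * x ^ p)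
    (Filter.Eventually.of_forall fun x hx => hpw x (by
      rw [Set.uIoc_of_le hv] at hx
      exact hx.1)),
    intervalIntegral.integral_add
      (((continuous_rpow_const hr.le).const_mul _).intervalIntegrable _ _)
      (((continuous_rpow_const hp.le).const_mul _).intervalIntegrable _ _),
    intervalIntegral.integral_const_mul, intervalIntegral.integral_const_mul,
    integral_rpow (Or.inl (by linarith)), integral_rpow (Or.inl (by linarith)),
    zero_rpow (by linarith), zero_rpow (by linarith)]
  ring

/-- Above the threshold `2λ^{p/(p-r)}`, the term `v^p` dominates in `λ v^r + v^p`. -/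
theorem lower_power_le_of_threshold {lam r p v : ℝ} (hlam : 0 < lam) (hr : 0 < r) (hrp : r < p)
    (hv : 0 ≤ v) (h : 2 * lam ^ (p / (p - r)) ≤ lam * v ^ r + v ^ p) :
    lam * v ^ r ≤ v ^ p := by
  have hpr : 0 < p - r := sub_pos.2 hrp
  set c := lam ^ (1 / (p - r)) with hc
  have hc0 : 0 < c := rpow_pos_of_pos hlam _
  have hcl : c ^ (p - r) = lam := by
    rw [hc, ← rpow_mul hlam.le, one_div_mul_cancel hpr.ne', rpow_one]
  have hcp : lam ^ (p / (p - r)) = c ^ p := by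
    rw [hc, ← rpow_mul hlam.le, one_div_mul_eq_div]
  have hcr : lam * c ^ r = c ^ p := by
    rw [← hcl, ← rpow_add hc0, sub_add_cancel]
  have hcv : c ≤ v := by
    by_contra! hlt
    have := strictMonoOn_power_sum hlam hr (hr.trans hrp) hv hc0.le hlt
    simp only at this
    linarith
  have hv0 : 0 < v := hc0.trans_le hcv
  calc lam * v ^ r = c ^ (p - r) * v ^ r := by rw [hcl]
    _ ≤ v ^ (p - r) * v ^ r := by gcongr
    _ = v ^ p := by rw [← rpow_add hv0, sub_add_cancel]

/-- For `s > 0` with `rs ≥ 1` and `τ = (ps−1)/(2^{(p+1)/p}(p+1)(s+1))`, one has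
`F̄_λ(t) − f_λ^{−1}(t)·t/(s+1) ≥ τ·|t|^{(p+1)/p}` for all `|t| ≥ 2λ^{p/(p−r)}`. -/
theorem stmt_9 (lam r p s : ℝ) (hlam : 0 < lam) (hr : 0 < r) (hrp : r < p)
    (hs : 0 < s) (hrs : 1 ≤ r * s)
    (f finv Fbar : ℝ → ℝ)
    (hf : ∀ t : ℝ, f t = lam * |t| ^ (r - 1) * t + |t| ^ (p - 1) * t)
    (hinv₁ : ∀ t : ℝ, f (finv t) = t) (hinv₂ : ∀ t : ℝ, finv (f t) = t)
    (hF : ∀ t : ℝ, Fbar t = ∫ u in (0:ℝ)..t, finv u)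
    (tau : ℝ) (htau : tau = (p * s - 1) / ((2:ℝ) ^ ((p + 1) / p) * (p + 1) * (s + 1))) :
    ∀ t : ℝ, 2 * lam ^ (p / (p - r)) ≤ |t| →
      Fbar t - finv t * t / (s + 1) ≥ tau * |t| ^ ((p + 1) / p) := by
  have hp : 0 < p := hr.trans hrp
  have hf' : ∀ x : ℝ, 0 ≤ x → f x = lam * x ^ r + x ^ p := fun x hx => by
    rw [hf, signed_power_sum_of_nonneg hr hp hx]
  have hodd : ∀ x : ℝ, f (-x) = -f x := fun x => by
    simp only [hf, abs_neg]
    ring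
  have hmono : StrictMono f := by
    refine strictMono_of_odd_strictMonoOn_nonneg hodd ?_
    exact (strictMonoOn_power_sum hlam hr hp).congr fun x hx => (hf' x hx).symm
  have hcont : Continuous finv := (hmono.orderIsoOfRightInverse f finv hinv₁).symm.continuous
  have hiodd : ∀ x : ℝ, finv (-x) = -finv x := fun x => by
    rw [← hinv₂ (-finv x), hodd, hinv₁]
  have hFeven : ∀ x : ℝ, Fbar (-x) = Fbar x := fun x => by
    have h := intervalIntegral.integral_comp_neg (a := 0) (b := x) finv
    simp only [hiodd, intervalIntegral.integral_neg, neg_zero] at h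
    rw [hF, hF, intervalIntegral.integral_symm, ← h, neg_neg]
  have hmain : ∀ t : ℝ, 0 ≤ t → 2 * lam ^ (p / (p - r)) ≤ t →
      Fbar t - finv t * t / (s + 1) ≥ tau * t ^ ((p + 1) / p) := by
    intro t ht hlt
    obtain ⟨v, rfl⟩ : ∃ v, f v = t := ⟨finv t, hinv₁ t⟩
    have hv : 0 ≤ v := by
      have hzero : f 0 = 0 := by simp [hf]
      rwa [← hzero, hmono.le_iff_le] at ht
    rw [hF, hinv₂]
    rw [hf' v hv] at hlt ht ⊢
    rw [integral_inverse_power_sum hr hp hv hcont fun x hx => by rw [← hf' x hx, hinv₂]]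
    have hdom := lower_power_le_of_threshold hlam hr hrp hv hlt
    have hps : 0 ≤ p * s - 1 := by nlinarith
    have hpow : (lam * v ^ r + v ^ p) ^ ((p + 1) / p) ≤ 2 ^ ((p + 1) / p) * v ^ (p + 1) := by
      calc (lam * v ^ r + v ^ p) ^ ((p + 1) / p) ≤ (2 * v ^ p) ^ ((p + 1) / p) :=
            rpow_le_rpow ht (by linarith) (by positivity)
        _ = 2 ^ ((p + 1) / p) * v ^ (p + 1) := by
            rw [mul_rpow (by norm_num) (by positivity), ← rpow_mul hv, mul_div_cancel₀ _ hp.ne']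
    have htau0 : 0 ≤ tau := by
      rw [htau]
      positivity
    have hlow : tau * (lam * v ^ r + v ^ p) ^ ((p + 1) / p) ≤
        (p * s - 1) / ((p + 1) * (s + 1)) * v ^ (p + 1) := by
      refine (mul_le_mul_of_nonneg_left hpow htau0).trans_eq ?_
      rw [htau]
      field_simp
    have hrterm : 0 ≤ (r * s - 1) / ((r + 1) * (s + 1)) * (lam * v ^ (r + 1)) :=
      mul_nonneg (div_nonneg (by linarith) (by positivity)) (by positivity)
    have hid : lam * r / (r + 1) * v ^ (r + 1) + p / (p + 1) * v ^ (p + 1) -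
        v * (lam * v ^ r + v ^ p) / (s + 1) =
        (r * s - 1) / ((r + 1) * (s + 1)) * (lam * v ^ (r + 1)) +
          (p * s - 1) / ((p + 1) * (s + 1)) * v ^ (p + 1) := by
      rw [rpow_add_one' hv (by positivity), rpow_add_one' hv (by positivity)]
      field_simp
      ring
    rw [hid]
    linarith
  intro t ht
  rcases le_total 0 t with h | h
  · rw [abs_of_nonneg h] at ht ⊢
    exact hmain t h ht
  · rw [abs_of_nonpos h] at ht ⊢
    simpa only [hFeven, hiodd, neg_mul_neg] using hmain (-t) (neg_nonneg.2 h) ht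
end

section
/- For all α, β ∈ ℝ there exists θ ∈ (0, 1) such that 0 ≤ f_λ^{−1}(α+β)·(α+β) ≤ f_λ^{−1}(α)·α + ((r+1)/r)·|β|·|f_λ^{−1}(α + θβ)|. -/
open Real

lemma abs_rpow_sub_one_mul_self_s10 {q t : ℝ} (hq : 0 < q) (ht : 0 ≤ t) :
    |t| ^ (q - 1) * t = t ^ q := by
  rcases ht.eq_or_lt with rfl | h
  · simp [hq.ne']
  · rw [abs_of_pos h, rpow_sub_one h.ne']
    field_simp

lemma strictMono_abs_rpow_sum {lam r p : ℝ} (hlam : 0 < lam) (hr : 0 < r) (hp : 0 < p)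
    {f : ℝ → ℝ} (hf : ∀ t : ℝ, f t = lam * |t| ^ (r - 1) * t + |t| ^ (p - 1) * t) :
    StrictMono f := by
  refine strictMono_of_odd_strictMonoOn_nonneg (fun t => ?_) fun a ha b hb hab => ?_
  · rw [hf, hf, abs_neg]
    ring
  · simp only [Set.mem_Ici] at ha hb
    rw [hf, hf, mul_assoc, mul_assoc, abs_rpow_sub_one_mul_self_s10 hr ha,
      abs_rpow_sub_one_mul_self_s10 hp ha, abs_rpow_sub_one_mul_self_s10 hr hb,
      abs_rpow_sub_one_mul_self_s10 hp hb]
    have h₁ := rpow_lt_rpow ha hab hr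
    have h₂ := rpow_lt_rpow ha hab hp
    gcongr

/-- If `g` inverts `f` near `s > 0` and `f` has elasticity at least `r` at `g s`, then
`x ↦ g x * x` has derivative of absolute value at most `(r + 1) / r * |g s|` at `s`. -/
lemma exists_hasDerivAt_inverse_mul_self {f g : ℝ → ℝ} {r s f' : ℝ} (hr : 0 < r) (hs : 0 < s)
    (hgs : 0 < g s) (hg : ContinuousAt g s) (hfg : ∀ t, f (g t) = t)
    (hf : HasDerivAt f f' (g s)) (hel : r * s ≤ f' * g s) :
    ∃ d, HasDerivAt (fun x => g x * x) d s ∧ |d| ≤ (r + 1) / r * |g s| := by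
  have hf' : 0 < f' := by
    by_contra! h
    nlinarith [mul_pos hr hs, mul_nonneg (neg_nonneg.2 h) hgs.le]
  have hd := (hf.of_local_left_inverse hg hf'.ne' (.of_forall hfg)).mul (hasDerivAt_id s)
  refine ⟨_, hd, ?_⟩
  have hle : f'⁻¹ * s ≤ g s / r := by
    rw [inv_mul_eq_div, div_le_div_iff₀ hf' hr]
    linarith
  have hsum : (r + 1) / r * g s = g s + g s / r := by
    field_simp
  simp only [id, mul_one]
  rw [abs_of_pos (by positivity), abs_of_pos hgs, hsum]
  linarith

/-- For all `α, β ∈ ℝ` there exists `θ ∈ (0,1)` with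
`0 ≤ f_λ^{−1}(α+β)(α+β) ≤ f_λ^{−1}(α)α + ((r+1)/r)|β||f_λ^{−1}(α+θβ)|`. -/
theorem stmt_10 (lam r p : ℝ) (hlam : 0 < lam) (hr : 0 < r) (hrp : r < p)
    (f finv : ℝ → ℝ)
    (hf : ∀ t : ℝ, f t = lam * |t| ^ (r - 1) * t + |t| ^ (p - 1) * t)
    (hinv₁ : ∀ t : ℝ, f (finv t) = t) (hinv₂ : ∀ t : ℝ, finv (f t) = t) :
    ∀ α β : ℝ, ∃ θ ∈ Set.Ioo (0:ℝ) 1,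
      0 ≤ finv (α + β) * (α + β) ∧
      finv (α + β) * (α + β)
        ≤ finv α * α + (r + 1) / r * |β| * |finv (α + θ * β)| := by
  have hp : 0 < p := hr.trans hrp
  have hmono : StrictMono f := strictMono_abs_rpow_sum hlam hr hp hf
  have hodd : ∀ t, finv (-t) = -finv t := fun t =>
    hmono.injective <| by
      rw [hinv₁, hf, abs_neg]
      linarith [hf (finv t), hinv₁ t]
  have hginc : StrictMono finv := fun a b hab =>
    hmono.lt_iff_lt.1 (by rwa [hinv₁, hinv₁])
  have hcont : Continuous finv :=
    hginc.monotone.continuous_of_surjective fun t => ⟨f t, hinv₂ t⟩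
  have h0 : finv 0 = 0 := by
    have := hodd 0
    rw [neg_zero] at this
    linarith
  have hderiv_pos : ∀ s, 0 < s → ∃ d, HasDerivAt (fun x => finv x * x) d s ∧
      |d| ≤ (r + 1) / r * |finv s| := by
    intro s hs
    have hu : 0 < finv s := h0 ▸ hginc hs
    have heq : ∀ t, 0 ≤ t → f t = lam * t ^ r + t ^ p := fun t ht => by
      rw [hf, mul_assoc, abs_rpow_sub_one_mul_self_s10 hr ht, abs_rpow_sub_one_mul_self_s10 hp ht]
    have hfd : HasDerivAt f (lam * (r * finv s ^ (r - 1)) + p * finv s ^ (p - 1)) (finv s) := by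
      refine (((hasDerivAt_rpow_const (.inl hu.ne')).const_mul lam).add
        (hasDerivAt_rpow_const (.inl hu.ne'))).congr_of_eventuallyEq ?_
      filter_upwards [lt_mem_nhds hu] with t ht using heq t (le_of_lt ht)
    refine exists_hasDerivAt_inverse_mul_self hr hs hu hcont.continuousAt hinv₁ hfd ?_
    have hs' : s = lam * finv s ^ r + finv s ^ p := by rw [← heq _ hu.le, hinv₁]
    have h₁ := abs_rpow_sub_one_mul_self_s10 hr hu.le
    have h₂ := abs_rpow_sub_one_mul_self_s10 hp hu.le
    rw [abs_of_pos hu] at h₁ h₂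
    calc r * s = r * (lam * finv s ^ r) + r * finv s ^ p := by rw [← mul_add, ← hs']
      _ ≤ r * (lam * finv s ^ r) + p * finv s ^ p := by gcongr
      _ = _ := by rw [← h₁, ← h₂]; ring
  have hderiv : ∀ s, ∃ d, HasDerivAt (fun x => finv x * x) d s ∧
      |d| ≤ (r + 1) / r * |finv s| := by
    intro s
    rcases lt_trichotomy s 0 with hs | rfl | hs
    · obtain ⟨d, hd, hle⟩ := hderiv_pos (-s) (neg_pos.2 hs)
      refine ⟨-d, ?_, by rwa [abs_neg, ← abs_neg (finv s), ← hodd]⟩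
      have := hd.comp s (hasDerivAt_neg s)
      rw [mul_neg_one] at this
      refine this.congr_of_eventuallyEq (.of_forall fun x => ?_)
      simp [hodd]
    · refine ⟨0, ?_, by simp [h0]⟩
      rw [hasDerivAt_iff_tendsto_slope]
      have ht : Filter.Tendsto finv (nhdsWithin 0 {0}ᶜ) (nhds 0) := by
        simpa [h0] using (hcont.tendsto 0).mono_left nhdsWithin_le_nhds
      refine ht.congr' ?_
      filter_upwards [self_mem_nhdsWithin] with x hx
      have hx' : x ≠ 0 := hx
      simp [slope_def_field, hx']
    · exact hderiv_pos s hs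
  choose d hd hle using hderiv
  intro α β
  have hline : ∀ t : ℝ, HasDerivAt (fun t => finv (α + t * β) * (α + t * β))
      (d (α + t * β) * β) t := fun t => by
    have h : HasDerivAt (fun t => α + t * β) β t := by
      simpa using ((hasDerivAt_id t).mul_const β).const_add α
    exact (hd (α + t * β)).comp t h
  obtain ⟨θ, hθ, heq⟩ := exists_hasDerivAt_eq_slope _ _ (zero_lt_one' ℝ)
    (fun t _ => (hline t).continuousAt.continuousWithinAt) fun t _ => hline t
  refine ⟨θ, hθ, ?_, ?_⟩
  · rcases le_total 0 (α + β) with h | h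
    · exact mul_nonneg (h0 ▸ hginc.monotone h) h
    · exact mul_nonneg_of_nonpos_of_nonpos (h0 ▸ hginc.monotone h) h
  · simp only [one_mul, zero_mul, add_zero, sub_zero, div_one] at heq
    have h₁ : d (α + θ * β) * β ≤ (r + 1) / r * |finv (α + θ * β)| * |β| :=
      (le_abs_self _).trans (by rw [abs_mul]; gcongr; exact hle _)
    linarith
end

section
/- For every t > 0 the function m : ℝ → ℝ defined by m(x) = f_λ^{−1}(x)·x is differentiable at t with derivative m'(t) = f_λ^{−1}(t) + t·f_λ^{−1}(t)/(λ·r·(f_λ^{−1}(t))^r + p·(f_λ^{−1}(t))^p), and this derivative satisfies 0 < m'(t) < ((r+1)/r)·f_λ^{−1}(t); consequently |m'(t)| ≤ ((r+1)/r)·|f_λ^{−1}(t)| for every t ≠ 0. -/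
open Real

/-- If `g` is a left inverse of `f`, and `f s = lam * s ^ r + s ^ p` for all `s > 0`, then `g` is
differentiable at `f s` for every `s > 0`. -/
theorem hasDerivAt_leftInverse_sum_rpow {lam r p : ℝ} (hlam : 0 < lam) (hr : 0 < r) (hp : 0 < p)
    {f g : ℝ → ℝ} (hf : ∀ s : ℝ, 0 < s → f s = lam * s ^ r + s ^ p)
    (hg : ∀ s : ℝ, g (f s) = s) {s : ℝ} (hs : 0 < s) :
    HasDerivAt g (s / (lam * r * s ^ r + p * s ^ p)) (f s) := by
  have h₁ : HasStrictDerivAt (fun x : ℝ => lam * x ^ r + x ^ p)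
      (lam * (r * s ^ (r - 1)) + p * s ^ (p - 1)) s :=
    ((Real.hasStrictDerivAt_rpow_const (Or.inl hs.ne')).const_mul lam).add
      (Real.hasStrictDerivAt_rpow_const (Or.inl hs.ne'))
  have h₂ : HasStrictDerivAt f (lam * (r * s ^ (r - 1)) + p * s ^ (p - 1)) s := by
    refine h₁.congr_of_eventuallyEq ?_
    filter_upwards [lt_mem_nhds hs] with x hx using (hf x hx).symm
  have hpos : 0 < lam * (r * s ^ (r - 1)) + p * s ^ (p - 1) := by positivity
  have h₃ := (h₂.to_local_left_inverse hpos.ne' (Filter.Eventually.of_forall hg)).hasDerivAt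
  refine h₃.congr_deriv ?_
  rw [Real.rpow_sub_one hs.ne', Real.rpow_sub_one hs.ne']
  field_simp

/-- For every `t > 0`, `m(x) = f_λ^{−1}(x)·x` is differentiable at `t` with
`m'(t) = f_λ^{−1}(t) + t·f_λ^{−1}(t)/(λr(f_λ^{−1}(t))^r + p(f_λ^{−1}(t))^p)`,
and `0 < m'(t) < ((r+1)/r)·f_λ^{−1}(t)`; consequently
`|m'(t)| ≤ ((r+1)/r)·|f_λ^{−1}(t)|` for every `t ≠ 0`. -/
theorem stmt_11 (lam r p : ℝ) (hlam : 0 < lam) (hr : 0 < r) (hrp : r < p)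
    (f finv : ℝ → ℝ)
    (hf : ∀ t : ℝ, f t = lam * |t| ^ (r - 1) * t + |t| ^ (p - 1) * t)
    (hinv₁ : ∀ t : ℝ, f (finv t) = t) (hinv₂ : ∀ t : ℝ, finv (f t) = t) :
    (∀ t : ℝ, 0 < t →
      HasDerivAt (fun x : ℝ => finv x * x)
        (finv t + t * finv t / (lam * r * (finv t) ^ r + p * (finv t) ^ p)) t ∧
      0 < finv t + t * finv t / (lam * r * (finv t) ^ r + p * (finv t) ^ p) ∧
      finv t + t * finv t / (lam * r * (finv t) ^ r + p * (finv t) ^ p)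
        < (r + 1) / r * finv t) ∧
    (∀ t : ℝ, t ≠ 0 →
      |deriv (fun x : ℝ => finv x * x) t| ≤ (r + 1) / r * |finv t|) := by
  have hfpos : ∀ s : ℝ, 0 < s → f s = lam * s ^ r + s ^ p := by
    intro s hs
    rw [hf, abs_of_pos hs, Real.rpow_sub_one hs.ne', Real.rpow_sub_one hs.ne']
    field_simp
  have hodd : ∀ t : ℝ, finv (-t) = -finv t := by
    intro t
    have h : f (-finv t) = -t := by
      conv_rhs => rw [← hinv₁ t]
      rw [hf, hf, abs_neg]
      ring
    rw [← h, hinv₂]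
  have hpos : ∀ t : ℝ, 0 < t → 0 < finv t := by
    intro t ht
    by_contra! hs
    have h := hinv₁ t
    rw [hf, ← add_mul] at h
    have h' : (lam * |finv t| ^ (r - 1) + |finv t| ^ (p - 1)) * finv t ≤ 0 :=
      mul_nonpos_of_nonneg_of_nonpos (by positivity) hs
    linarith
  have hp : 0 < p := hr.trans hrp
  have main : ∀ t : ℝ, 0 < t →
      HasDerivAt (fun x : ℝ => finv x * x)
        (finv t + t * finv t / (lam * r * (finv t) ^ r + p * (finv t) ^ p)) t ∧
      0 < finv t + t * finv t / (lam * r * (finv t) ^ r + p * (finv t) ^ p) ∧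
      finv t + t * finv t / (lam * r * (finv t) ^ r + p * (finv t) ^ p)
        < (r + 1) / r * finv t := by
    intro t ht
    have hs := hpos t ht
    have hd := hasDerivAt_leftInverse_sum_rpow hlam hr hp hfpos hinv₂ hs
    rw [hinv₁] at hd
    have ht' : t = lam * finv t ^ r + finv t ^ p := by rw [← hfpos _ hs, hinv₁]
    have hD : 0 < lam * r * finv t ^ r + p * finv t ^ p := by positivity
    refine ⟨?_, by positivity, ?_⟩
    · refine (hd.mul (hasDerivAt_id' t)).congr_deriv ?_
      ring
    · have hlt : r * t < lam * r * finv t ^ r + p * finv t ^ p := by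
        have := mul_lt_mul_of_pos_right hrp (Real.rpow_pos_of_pos hs p)
        calc r * t = lam * r * finv t ^ r + r * finv t ^ p := by
              conv_lhs => rw [ht']
              ring
          _ < _ := by linarith
      have hq : t * finv t / (lam * r * finv t ^ r + p * finv t ^ p) < finv t / r := by
        rw [div_lt_div_iff₀ hD hr]
        nlinarith [mul_lt_mul_of_pos_left hlt hs]
      have he : (r + 1) / r * finv t = finv t + finv t / r := by
        field_simp
      linarith
  have bound : ∀ t : ℝ, 0 < t →
      |deriv (fun x : ℝ => finv x * x) t| ≤ (r + 1) / r * |finv t| := by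
    intro t ht
    obtain ⟨h₁, h₂, h₃⟩ := main t ht
    rw [h₁.deriv, abs_of_pos h₂, abs_of_pos (hpos t ht)]
    exact h₃.le
  refine ⟨main, fun t ht => ?_⟩
  rcases ht.lt_or_gt with ht | ht
  · have heven : (fun x : ℝ => finv x * x) = fun x : ℝ => (fun y : ℝ => finv y * y) (-x) := by
      funext x
      simp [hodd]
    have h := bound (-t) (neg_pos.mpr ht)
    rw [heven, deriv_comp_neg (fun y : ℝ => finv y * y), abs_neg]
    rwa [hodd, abs_neg] at h
  · exact bound t ht
end

section
/- One has lim_{t → +∞} (t^{(p+1)/p} − f_λ^{−1}(t)·t)/t^{(r+1)/p} = λ/p. -/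
open Real Filter

/-- The difference quotient of `x ↦ (1 + x) ^ a` at `0` tends to `a`. -/
lemma tendsto_one_add_rpow_sub_one_div (a : ℝ) :
    Tendsto (fun x : ℝ => ((1 + x) ^ a - 1) / x) (nhdsWithin 0 {0}ᶜ) (nhds a) := by
  have h : HasDerivAt (fun x : ℝ => (1 + x) ^ a) a 0 := by
    have h1 : HasDerivAt (fun x : ℝ => 1 + x) 1 0 := (hasDerivAt_id 0).const_add 1
    simpa using h1.rpow_const (p := a) (Or.inl (by norm_num))
  have h2 := h.tendsto_slope_zero
  refine h2.congr fun x => ?_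
  simp [div_eq_inv_mul]

/-- A right inverse of a function that is nonpositive on `(-∞, 0]` and monotone on `(0, ∞)`
tends to infinity. -/
lemma tendsto_atTop_of_rightInverse {f g : ℝ → ℝ} (hneg : ∀ s ≤ 0, f s ≤ 0)
    (hmono : ∀ s t, 0 < s → s ≤ t → f s ≤ f t) (hfg : ∀ t, f (g t) = t) :
    Tendsto g atTop atTop := by
  refine tendsto_atTop.2 fun M => ?_
  filter_upwards [eventually_gt_atTop 0, eventually_gt_atTop (f M)] with t ht htM
  by_contra! hlt
  rcases le_or_gt (g t) 0 with h | h
  · have := hneg _ h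
    rw [hfg] at this
    linarith
  · have := hmono _ _ h hlt.le
    rw [hfg] at this
    linarith

/-- The error quotient along `t = lam * s ^ r + s ^ p`, in the variable
`x = lam * s ^ (r - p)`. -/
lemma inverse_error_quotient_eq {lam r p s t : ℝ} (hlam : 0 < lam) (hp : 0 < p) (hs : 0 < s)
    (ht : t = lam * s ^ r + s ^ p) :
    (t ^ ((p + 1) / p) - s * t) / t ^ ((r + 1) / p) =
      lam * (((1 + lam * s ^ (r - p)) ^ (1 / p) - 1) / (lam * s ^ (r - p))) *
        (1 + lam * s ^ (r - p)) ^ (1 - (r + 1) / p) := by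
  have hsr : 0 < s ^ (r - p) := rpow_pos_of_pos hs _
  have hy : 0 < 1 + lam * s ^ (r - p) := by positivity
  have hsr' : s ^ r = s ^ p * s ^ (r - p) := by
    rw [← rpow_add hs]; congr 1; ring
  have htx : t = s ^ p * (1 + lam * s ^ (r - p)) := by
    rw [ht, hsr']; ring
  have e1 : s ^ (p * ((p + 1) / p)) = s ^ p * s := by
    rw [mul_div_cancel₀ _ hp.ne', rpow_add_one hs.ne']
  have e2 : s ^ (p * ((r + 1) / p)) = s ^ p * s ^ (r - p) * s := by
    rw [mul_div_cancel₀ _ hp.ne', rpow_add_one hs.ne', hsr']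
  have hsp : 0 < s ^ p := rpow_pos_of_pos hs _
  rw [htx, mul_rpow hsp.le hy.le, mul_rpow hsp.le hy.le, ← rpow_mul hs.le, ← rpow_mul hs.le,
    e1, e2, rpow_sub hy, rpow_one, show (p + 1) / p = 1 + 1 / p by field_simp,
    rpow_add hy, rpow_one]
  have hyr : 0 < (1 + lam * s ^ (r - p)) ^ ((r + 1) / p) := rpow_pos_of_pos hy _
  generalize (1 + lam * s ^ (r - p)) ^ ((r + 1) / p) = c at *
  generalize (1 + lam * s ^ (r - p)) ^ (1 / p) = d at *
  field_simp

/-- `lim_{t → +∞} (t^{(p+1)/p} − f_λ^{−1}(t)·t)/t^{(r+1)/p} = λ/p`. -/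
theorem stmt_12 (lam r p : ℝ) (hlam : 0 < lam) (hr : 0 < r) (hrp : r < p)
    (f finv : ℝ → ℝ)
    (hf : ∀ t : ℝ, f t = lam * |t| ^ (r - 1) * t + |t| ^ (p - 1) * t)
    (hinv₁ : ∀ t : ℝ, f (finv t) = t) (hinv₂ : ∀ t : ℝ, finv (f t) = t) :
    Tendsto (fun t : ℝ => (t ^ ((p + 1) / p) - finv t * t) / t ^ ((r + 1) / p))
      atTop (nhds (lam / p)) := by
  have hp : 0 < p := hr.trans hrp
  have hfpos : ∀ s, 0 < s → f s = lam * s ^ r + s ^ p := by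
    intro s hs
    rw [hf, abs_of_pos hs, mul_assoc, ← rpow_add_one hs.ne', ← rpow_add_one hs.ne',
      sub_add_cancel, sub_add_cancel]
  have hneg : ∀ s ≤ 0, f s ≤ 0 := by
    intro s hs
    rw [hf, ← add_mul]
    exact mul_nonpos_of_nonneg_of_nonpos (by positivity) hs
  have hmono : ∀ s t, 0 < s → s ≤ t → f s ≤ f t := by
    intro s t hs hst
    rw [hfpos s hs, hfpos t (hs.trans_le hst)]
    gcongr
  have hinf := tendsto_atTop_of_rightInverse hneg hmono hinv₁
  have hx : Tendsto (fun t => lam * finv t ^ (r - p)) atTop (nhds 0) := by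
    have h := ((tendsto_rpow_neg_atTop (sub_pos.2 hrp)).comp hinf).const_mul lam
    simpa [Function.comp_def] using h
  have hx' : Tendsto (fun t => lam * finv t ^ (r - p)) atTop (nhdsWithin 0 {0}ᶜ) := by
    refine tendsto_nhdsWithin_iff.2 ⟨hx, ?_⟩
    filter_upwards [hinf.eventually_gt_atTop 0] with t ht
    exact (mul_pos hlam (rpow_pos_of_pos ht _)).ne'
  have hpow : Tendsto (fun t => (1 + lam * finv t ^ (r - p)) ^ (1 - (r + 1) / p)) atTop
      (nhds 1) := by
    simpa using (hx.const_add 1).rpow_const (p := 1 - (r + 1) / p) (Or.inl (by norm_num))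
  have hlim := (((tendsto_one_add_rpow_sub_one_div (1 / p)).comp hx').const_mul lam).mul hpow
  rw [mul_one, mul_one_div] at hlim
  refine hlim.congr' ?_
  filter_upwards [hinf.eventually_gt_atTop 0] with t ht
  exact (inverse_error_quotient_eq hlam hp ht (by rw [← hfpos _ ht, hinv₁])).symm
end

section
/- For every real number c with 0 < c < λ/p there exists t₀ > 0 such that for all t ∈ ℝ with |t| ≥ t₀ one has 0 ≤ f_λ^{−1}(t)·t ≤ |t|^{(p+1)/p} − c·|t|^{(r+1)/p}. -/
open Real

/-- The auxiliary function `ε ↦ λ ε (1 - cε)^r + (1 - cε)^p` exceeds its value `1` at the origin for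
small `ε > 0`, provided that `c p < λ`. -/
lemma eventually_one_lt_perturbation {lam r p c : ℝ} (h : c * p < lam) :
    ∀ᶠ ε in nhdsWithin (0 : ℝ) (Set.Ioi 0),
      1 < lam * ε * (1 - c * ε) ^ r + (1 - c * ε) ^ p := by
  have hlin : HasDerivAt (fun ε : ℝ => 1 - c * ε) (-c) 0 := by
    simpa using ((hasDerivAt_id (0 : ℝ)).const_mul c).const_sub 1
  have hmul : HasDerivAt (fun ε : ℝ => lam * ε) lam 0 := by
    simpa using (hasDerivAt_id (0 : ℝ)).const_mul lam
  have hd : HasDerivAt (fun ε : ℝ => lam * ε * (1 - c * ε) ^ r + (1 - c * ε) ^ p)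
      (lam - c * p) 0 := by
    have := (hmul.mul (hlin.rpow_const (p := r) (Or.inl (by simp)))).add
      (hlin.rpow_const (p := p) (Or.inl (by simp)))
    exact this.congr_deriv (by simp; ring)
  have hs := (hasDerivAt_iff_tendsto_slope.1 hd).mono_left
    (nhdsWithin_mono (0 : ℝ) (fun x (hx : x ∈ Set.Ioi (0 : ℝ)) => ne_of_gt hx))
  filter_upwards [hs.eventually (lt_mem_nhds (sub_pos.2 h)), self_mem_nhdsWithin] with ε h1 h2
  rw [slope_def_field] at h1
  have h3 := (div_pos_iff_of_pos_right (by simpa using h2)).1 h1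
  simpa using h3

/-- Asymptotic upper bound for the positive solution `s` of `λ s^r + s^p = x` as `x → ∞`. -/
lemma eventually_le_of_rpow_add_rpow_eq {lam r p c : ℝ} (hlam : 0 < lam) (hr : 0 < r) (hrp : r < p)
    (hc : c * p < lam) :
    ∀ᶠ x in Filter.atTop, ∀ s : ℝ, 0 < s → lam * s ^ r + s ^ p = x →
      s * x ≤ x ^ ((p + 1) / p) - c * x ^ ((r + 1) / p) := by
  have hp : 0 < p := hr.trans hrp
  have hlim : Filter.Tendsto (fun x : ℝ => x ^ (-((p - r) / p))) Filter.atTop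
      (nhdsWithin 0 (Set.Ioi 0)) :=
    tendsto_nhdsWithin_iff.2 ⟨tendsto_rpow_neg_atTop (div_pos (sub_pos.2 hrp) hp),
      (Filter.eventually_gt_atTop 0).mono fun x hx => rpow_pos_of_pos hx _⟩
  have hsmall : ∀ᶠ ε in nhdsWithin (0 : ℝ) (Set.Ioi 0), 0 < 1 - c * ε := by
    have : ContinuousAt (fun ε : ℝ => 1 - c * ε) 0 := by fun_prop
    exact (this.eventually (lt_mem_nhds (by simp))).filter_mono nhdsWithin_le_nhds
  filter_upwards [hlim.eventually (eventually_one_lt_perturbation (r := r) hc),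
    hlim.eventually hsmall, Filter.eventually_gt_atTop 0] with x h1 h2 hx s hs hsx
  set ε := x ^ (-((p - r) / p)) with hε
  set u := x ^ (1 / p) with hu
  have hu0 : 0 < u := rpow_pos_of_pos hx _
  have hup : u ^ p = x := by
    rw [hu, ← rpow_mul hx.le, one_div_mul_cancel hp.ne', rpow_one]
  have hur : u ^ r = x * ε := by
    rw [hu, hε, ← rpow_mul hx.le, ← rpow_one_add' hx.le]
    · congr 1; field_simp; ring
    · have : 1 + -((p - r) / p) = r / p := by field_simp; ring
      rw [this]; positivity
  have e1 : x ^ ((p + 1) / p) = x * u := by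
    rw [hu, ← rpow_one_add' hx.le (by positivity)]
    congr 1; field_simp
  have e2 : x ^ ((r + 1) / p) = x * u * ε := by
    rw [← e1, hε, ← rpow_add hx]
    congr 1; field_simp; ring
  have key : s ≤ u * (1 - c * ε) := by
    by_contra! hlt
    have hy : 0 ≤ u * (1 - c * ε) := by positivity
    have a1 := rpow_lt_rpow hy hlt hr
    have a2 := rpow_lt_rpow hy hlt hp
    rw [mul_rpow hu0.le h2.le, hur] at a1
    rw [mul_rpow hu0.le h2.le, hup] at a2
    have a3 := mul_lt_mul_of_pos_left a1 hlam
    have a4 := mul_lt_mul_of_pos_left h1 hx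
    linarith
  rw [e1, e2]
  have := mul_le_mul_of_nonneg_right key hx.le
  linarith

/-- For every `0 < c < λ/p` there exists `t₀ > 0` such that for all `|t| ≥ t₀`,
`0 ≤ f_λ^{−1}(t)·t ≤ |t|^{(p+1)/p} − c·|t|^{(r+1)/p}`. -/
theorem stmt_13 (lam r p : ℝ) (hlam : 0 < lam) (hr : 0 < r) (hrp : r < p)
    (f finv : ℝ → ℝ)
    (hf : ∀ t : ℝ, f t = lam * |t| ^ (r - 1) * t + |t| ^ (p - 1) * t)
    (hinv₁ : ∀ t : ℝ, f (finv t) = t) (hinv₂ : ∀ t : ℝ, finv (f t) = t) :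
    ∀ c : ℝ, 0 < c → c < lam / p →
      ∃ t₀ : ℝ, 0 < t₀ ∧ ∀ t : ℝ, t₀ ≤ |t| →
        0 ≤ finv t * t ∧
        finv t * t ≤ |t| ^ ((p + 1) / p) - c * |t| ^ ((r + 1) / p) := by
  intro c _ hc
  obtain ⟨T, hT⟩ := Filter.eventually_atTop.1 (eventually_le_of_rpow_add_rpow_eq hlam hr hrp
    ((lt_div_iff₀ (hr.trans hrp)).1 hc))
  refine ⟨max T 1, by positivity, fun t ht => ?_⟩
  have ht0 : 0 < |t| := one_pos.trans_le ((le_max_right _ _).trans ht)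
  have hft : t = (lam * |finv t| ^ (r - 1) + |finv t| ^ (p - 1)) * finv t := by
    rw [add_mul, ← hf, hinv₁]
  have hs0 : finv t ≠ 0 := by
    intro h
    rw [h, mul_zero] at hft
    simp [hft] at ht0
  have hs : 0 < |finv t| := abs_pos.2 hs0
  have hnonneg : 0 ≤ finv t * t := by
    have : finv t * t
        = (lam * |finv t| ^ (r - 1) + |finv t| ^ (p - 1)) * (finv t * finv t) := by
      linear_combination finv t * hft
    rw [this]
    exact mul_nonneg (by positivity) (mul_self_nonneg _)
  have habs : lam * |finv t| ^ r + |finv t| ^ p = |t| := by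
    have h := congrArg abs hft
    rw [abs_mul, abs_of_nonneg (by positivity : 0 ≤ lam * |finv t| ^ (r - 1) + |finv t| ^ (p - 1)),
      add_mul, mul_assoc, ← rpow_add_one hs.ne', ← rpow_add_one hs.ne',
      sub_add_cancel, sub_add_cancel] at h
    exact h.symm
  refine ⟨hnonneg, ?_⟩
  have := hT |t| ((le_max_left _ _).trans ht) _ hs habs
  rwa [← abs_mul, abs_of_nonneg hnonneg] at this
end

section
/- Let s > 0. Then lim_{t → +∞} t^{−(p+1)/p}·(F̄_λ(t) − f_λ^{−1}(t)·t/(s+1)) = (ps − 1)/((p+1)(s+1)). -/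
open Real Filter

section PowerSumInverse

variable {lam r p : ℝ} {g : ℝ → ℝ}

/-- A right inverse of `x ↦ lam * x ^ r + x ^ p` on `[0, ∞)` is bounded by `t ^ (1 / p)`. -/
lemma rightInverse_le_rpow (hlam : 0 < lam) (hp : 0 < p) (hg0 : ∀ t, 0 ≤ t → 0 ≤ g t)
    (hg : ∀ t, 0 ≤ t → lam * g t ^ r + g t ^ p = t) {t : ℝ} (ht : 0 ≤ t) :
    g t ≤ t ^ (1 / p) := by
  have h := hg t ht
  have h1 : 0 ≤ lam * g t ^ r := mul_nonneg hlam.le (rpow_nonneg (hg0 t ht) r)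
  calc g t = (g t ^ p) ^ (1 / p) := by
        rw [← rpow_mul (hg0 t ht), mul_one_div_cancel hp.ne', rpow_one]
    _ ≤ t ^ (1 / p) := by
        apply rpow_le_rpow (rpow_nonneg (hg0 t ht) p) _ (by positivity)
        linarith

lemma rightInverse_monotoneOn (hlam : 0 < lam) (hr : 0 < r) (hp : 0 < p)
    (hg0 : ∀ t, 0 ≤ t → 0 ≤ g t)
    (hg : ∀ t, 0 ≤ t → lam * g t ^ r + g t ^ p = t) : MonotoneOn g (Set.Ici 0) := by
  intro a ha b hb hab
  by_contra! h
  have h1 := rpow_lt_rpow (hg0 b hb) h hr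
  have h2 := rpow_lt_rpow (hg0 b hb) h hp
  have h3 := mul_lt_mul_of_pos_left h1 hlam
  linarith [hg a ha, hg b hb]

lemma tendsto_rightInverse_mul_rpow (hlam : 0 < lam) (hr : 0 < r) (hrp : r < p)
    (hg0 : ∀ t, 0 ≤ t → 0 ≤ g t)
    (hg : ∀ t, 0 ≤ t → lam * g t ^ r + g t ^ p = t) :
    Tendsto (fun t => g t * t ^ (-(1 / p))) atTop (nhds 1) := by
  have hp : 0 < p := hr.trans hrp
  have hdecay : Tendsto (fun t : ℝ => 1 - lam * t ^ (-(1 - r / p))) atTop (nhds 1) := by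
    have h : 0 < 1 - r / p := by rw [sub_pos, div_lt_one hp]; exact hrp
    simpa using ((tendsto_rpow_neg_atTop h).const_mul lam).const_sub 1
  have hpow : Tendsto (fun t => (g t * t ^ (-(1 / p))) ^ p) atTop (nhds 1) := by
    have heq : ∀ t : ℝ, 0 < t → (g t * t ^ (-(1 / p))) ^ p = g t ^ p * t⁻¹ := fun t ht => by
      rw [mul_rpow (hg0 t ht.le) (by positivity), ← rpow_mul ht.le, neg_mul,
        one_div_mul_cancel hp.ne', rpow_neg_one]
    refine tendsto_of_tendsto_of_tendsto_of_le_of_le' hdecay tendsto_const_nhds ?_ ?_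
    · filter_upwards [eventually_gt_atTop 0] with t ht
      have h1 : g t ^ r ≤ t ^ (r / p) := by
        calc g t ^ r ≤ (t ^ (1 / p)) ^ r :=
              rpow_le_rpow (hg0 t ht.le) (rightInverse_le_rpow hlam hp hg0 hg ht.le) hr.le
          _ = t ^ (r / p) := by rw [← rpow_mul ht.le]; congr 1; ring
      have h2 : t ^ (-(1 - r / p)) = t ^ (r / p) * t⁻¹ := by
        rw [← rpow_neg_one t, ← rpow_add ht]; congr 1; ring
      have h3 : g t ^ p = t - lam * g t ^ r := by linarith [hg t ht.le]
      have h4 : lam * (g t ^ r * t⁻¹) ≤ lam * (t ^ (r / p) * t⁻¹) := by gcongr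
      rw [heq t ht, h2, h3, sub_mul, mul_inv_cancel₀ ht.ne']
      linarith
    · filter_upwards [eventually_gt_atTop 0] with t ht
      have h1 : 0 ≤ lam * g t ^ r := mul_nonneg hlam.le (rpow_nonneg (hg0 t ht.le) r)
      rw [heq t ht, ← div_eq_mul_inv, div_le_one ht]
      linarith [hg t ht.le]
  have hroot := hpow.rpow_const (p := 1 / p) (Or.inl one_ne_zero)
  rw [one_rpow] at hroot
  refine hroot.congr' ?_
  filter_upwards [eventually_gt_atTop 0] with t ht
  rw [← rpow_mul (mul_nonneg (hg0 t ht.le) (by positivity)), mul_one_div_cancel hp.ne', rpow_one]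

lemma tendsto_rpow_mul_integral_rightInverse (hlam : 0 < lam) (hr : 0 < r) (hrp : r < p)
    (hg0 : ∀ t, 0 ≤ t → 0 ≤ g t)
    (hg : ∀ t, 0 ≤ t → lam * g t ^ r + g t ^ p = t) :
    Tendsto (fun t => t ^ (-((p + 1) / p)) * ∫ u in (0:ℝ)..t, g u) atTop
      (nhds (p / (p + 1))) := by
  have hp : 0 < p := hr.trans hrp
  have hlim : Tendsto (fun t : ℝ => ∫ v in (0:ℝ)..1, g (t * v) * t ^ (-(1 / p))) atTop
      (nhds (∫ v in (0:ℝ)..1, v ^ (1 / p))) := by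
    apply intervalIntegral.tendsto_integral_filter_of_dominated_convergence (fun _ => 1)
    · filter_upwards [eventually_gt_atTop 0] with t ht
      refine (aemeasurable_restrict_of_monotoneOn measurableSet_uIoc ?_).aestronglyMeasurable
      rw [Set.uIoc_of_le zero_le_one]
      intro a ha b hb hab
      have h := rightInverse_monotoneOn hlam hr hp hg0 hg
        (mul_nonneg ht.le ha.1.le) (mul_nonneg ht.le hb.1.le)
        (mul_le_mul_of_nonneg_left hab ht.le)
      exact mul_le_mul_of_nonneg_right h (by positivity)
    · filter_upwards [eventually_gt_atTop 0] with t ht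
      refine MeasureTheory.ae_of_all _ fun v hv => ?_
      rw [Set.uIoc_of_le zero_le_one] at hv
      have htv : 0 ≤ t * v := mul_nonneg ht.le hv.1.le
      rw [norm_of_nonneg (mul_nonneg (hg0 _ htv) (by positivity)), rpow_neg ht.le,
        ← div_eq_mul_inv, div_le_one (by positivity)]
      refine (rightInverse_le_rpow hlam hp hg0 hg htv).trans ?_
      exact rpow_le_rpow htv (mul_le_of_le_one_right ht.le hv.2) (by positivity)
    · exact intervalIntegrable_const
    · refine MeasureTheory.ae_of_all _ fun v hv => ?_
      rw [Set.uIoc_of_le zero_le_one] at hv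
      have h := ((tendsto_rightInverse_mul_rpow hlam hr hrp hg0 hg).comp
        (tendsto_id.atTop_mul_const hv.1)).mul_const (v ^ (1 / p))
      rw [one_mul] at h
      refine h.congr' ?_
      filter_upwards [eventually_gt_atTop 0] with t ht
      have hv' : v ^ (-(1 / p)) * v ^ (1 / p) = 1 := by
        rw [← rpow_add hv.1, neg_add_cancel, rpow_zero]
      simp only [Function.comp, id]
      rw [mul_rpow ht.le hv.1.le, mul_assoc, mul_assoc, hv', mul_one]
  have hval : ∫ v in (0:ℝ)..1, v ^ (1 / p) = p / (p + 1) := by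
    have h : 0 < 1 / p := by positivity
    rw [integral_rpow (Or.inl (by linarith)), one_rpow, zero_rpow (by positivity)]
    field_simp
    ring
  rw [hval] at hlim
  refine hlim.congr' ?_
  filter_upwards [eventually_gt_atTop 0] with t ht
  rw [intervalIntegral.integral_mul_const, intervalIntegral.integral_comp_mul_left g ht.ne',
    mul_zero, mul_one, smul_eq_mul]
  have h : t ^ (-((p + 1) / p)) = t⁻¹ * t ^ (-(1 / p)) := by
    rw [← rpow_neg_one t, ← rpow_add ht]; congr 1; field_simp; ring
  rw [h]
  ring

end PowerSumInverse

/-- For `s > 0`: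
`lim_{t → +∞} t^{−(p+1)/p}·(F̄_λ(t) − f_λ^{−1}(t)·t/(s+1)) = (ps − 1)/((p+1)(s+1))`. -/
theorem stmt_15 (lam r p s : ℝ) (hlam : 0 < lam) (hr : 0 < r) (hrp : r < p) (hs : 0 < s)
    (f finv Fbar : ℝ → ℝ)
    (hf : ∀ t : ℝ, f t = lam * |t| ^ (r - 1) * t + |t| ^ (p - 1) * t)
    (hinv₁ : ∀ t : ℝ, f (finv t) = t) (hinv₂ : ∀ t : ℝ, finv (f t) = t)
    (hF : ∀ t : ℝ, Fbar t = ∫ u in (0:ℝ)..t, finv u) :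
    Tendsto (fun t : ℝ => t ^ (-((p + 1) / p)) * (Fbar t - finv t * t / (s + 1)))
      atTop (nhds ((p * s - 1) / ((p + 1) * (s + 1)))) := by
  have hp : 0 < p := hr.trans hrp
  have hg0 : ∀ t, 0 ≤ t → 0 ≤ finv t := by
    intro t ht
    by_contra! h
    have habs : 0 < |finv t| := abs_pos.mpr h.ne
    have h1 : lam * |finv t| ^ (r - 1) * finv t < 0 :=
      mul_neg_of_pos_of_neg (by positivity) h
    have h2 : |finv t| ^ (p - 1) * finv t < 0 := mul_neg_of_pos_of_neg (by positivity) h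
    linarith [hinv₁ t, hf (finv t)]
  have hmul : ∀ x q : ℝ, 0 ≤ x → 0 < q → |x| ^ (q - 1) * x = x ^ q := by
    intro x q hx hq
    rcases hx.eq_or_lt with rfl | hx
    · rw [mul_zero, zero_rpow hq.ne']
    · rw [abs_of_pos hx, ← rpow_add_one hx.ne', sub_add_cancel]
  have hg : ∀ t, 0 ≤ t → lam * finv t ^ r + finv t ^ p = t := by
    intro t ht
    rw [← hmul _ r (hg0 t ht) hr, ← hmul _ p (hg0 t ht) hp, ← mul_assoc, ← hf, hinv₁]
  have hlim := (tendsto_rpow_mul_integral_rightInverse hlam hr hrp hg0 hg).sub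
    ((tendsto_rightInverse_mul_rpow hlam hr hrp hg0 hg).div_const (s + 1))
  have hval : p / (p + 1) - 1 / (s + 1) = (p * s - 1) / ((p + 1) * (s + 1)) := by
    field_simp
    ring
  rw [hval] at hlim
  refine hlim.congr' ?_
  filter_upwards [eventually_gt_atTop 0] with t ht
  have h : t ^ (-(1 / p)) = t ^ (-((p + 1) / p)) * t := by
    rw [← rpow_add_one ht.ne']; congr 1; field_simp; ring
  rw [hF, h]
  ring
end

section
/- For every t ∈ ℝ with |t| ≥ 2λ^{p/(p−r)} one has f_λ^{−1}(t)·t ≥ 2^{−1/p}·|t|^{(p+1)/p}, and for every t ∈ ℝ with |t| ≤ 2λ^{p/(p−r)} one has f_λ^{−1}(t)·t ≥ (2λ)^{−1/r}·|t|^{(r+1)/r}. -/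
/-- If `T ≤ c * a ^ q` with `a ≥ 0`, then `c ^ (-(1 / q)) * T ^ ((q + 1) / q) ≤ a * T`. -/
lemma rpow_mul_rpow_le_mul_of_le_mul_rpow {c q a T : ℝ} (hc : 0 < c) (hq : 0 < q) (ha : 0 ≤ a)
    (hT : 0 < T) (h : T ≤ c * a ^ q) : c ^ (-(1 / q)) * T ^ ((q + 1) / q) ≤ a * T := by
  have h1 : (T / c) ^ (1 / q) ≤ a := by
    have h2 : T / c ≤ a ^ q := by rwa [div_le_iff₀' hc]
    calc (T / c) ^ (1 / q) ≤ (a ^ q) ^ (1 / q) :=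
          Real.rpow_le_rpow (by positivity) h2 (by positivity)
      _ = a := by rw [← Real.rpow_mul ha, mul_one_div_cancel hq.ne', Real.rpow_one]
  have h3 : (q + 1) / q = 1 / q + 1 := by field_simp; ring
  rw [h3, Real.rpow_add hT, Real.rpow_one, Real.rpow_neg hc.le, ← mul_assoc]
  refine mul_le_mul_of_nonneg_right (le_of_eq_of_le ?_ h1) hT.le
  rw [Real.div_rpow hT.le hc.le]
  exact (div_eq_inv_mul _ _).symm

/-- `f_λ^{−1}(t)·t ≥ 2^{−1/p}·|t|^{(p+1)/p}` for `|t| ≥ 2λ^{p/(p−r)}`, and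
`f_λ^{−1}(t)·t ≥ (2λ)^{−1/r}·|t|^{(r+1)/r}` for `|t| ≤ 2λ^{p/(p−r)}`. -/
theorem stmt_17 (lam r p : ℝ) (hlam : 0 < lam) (hr : 0 < r) (hrp : r < p)
    (f finv : ℝ → ℝ)
    (hf : ∀ t : ℝ, f t = lam * |t| ^ (r - 1) * t + |t| ^ (p - 1) * t)
    (hinv₁ : ∀ t : ℝ, f (finv t) = t) (hinv₂ : ∀ t : ℝ, finv (f t) = t) :
    (∀ t : ℝ, 2 * lam ^ (p / (p - r)) ≤ |t| →
      finv t * t ≥ (2:ℝ) ^ (-(1 / p)) * |t| ^ ((p + 1) / p)) ∧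
    (∀ t : ℝ, |t| ≤ 2 * lam ^ (p / (p - r)) →
      finv t * t ≥ (2 * lam) ^ (-(1 / r)) * |t| ^ ((r + 1) / r)) := by
  have hp : 0 < p := hr.trans hrp
  have hpr : 0 < p - r := sub_pos.2 hrp
  obtain ⟨m, hm, rfl⟩ : ∃ m : ℝ, 0 < m ∧ m ^ (p - r) = lam :=
    ⟨lam ^ (1 / (p - r)), by positivity, by
      rw [← Real.rpow_mul hlam.le, one_div_mul_cancel hpr.ne', Real.rpow_one]⟩
  have hmp : (m ^ (p - r)) ^ (p / (p - r)) = m ^ p := by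
    rw [← Real.rpow_mul hm.le, mul_div_cancel₀ _ hpr.ne']
  have hsplit : ∀ x : ℝ, 0 < x → x ^ (p - r) * x ^ r = x ^ p := fun x hx => by
    rw [← Real.rpow_add hx, sub_add_cancel]
  have key : ∀ t : ℝ, t ≠ 0 → 0 < |finv t| ∧ finv t * t = |finv t| * |t| ∧
      |t| = m ^ (p - r) * |finv t| ^ r + |finv t| ^ p := by
    intro t ht
    have hft := (hf (finv t)).symm.trans (hinv₁ t)
    set s := finv t
    have hs : s ≠ 0 := by
      intro h
      rw [h] at hft
      simp at hft
      exact ht hft.symm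
    have ha : 0 < |s| := abs_pos.2 hs
    have hk : t = (m ^ (p - r) * |s| ^ (r - 1) + |s| ^ (p - 1)) * s := by
      rw [add_mul]; exact hft.symm
    have hkpos : 0 < m ^ (p - r) * |s| ^ (r - 1) + |s| ^ (p - 1) := by positivity
    have habs : |t| = (m ^ (p - r) * |s| ^ (r - 1) + |s| ^ (p - 1)) * |s| := by
      have h := congrArg abs hk
      rwa [abs_mul, abs_of_pos hkpos] at h
    refine ⟨ha, ?_, ?_⟩
    · rw [habs]
      nth_rewrite 1 [hk]
      linear_combination (-(m ^ (p - r) * |s| ^ (r - 1) + |s| ^ (p - 1))) * abs_mul_abs_self s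
    · rw [habs, Real.rpow_sub_one ha.ne', Real.rpow_sub_one ha.ne']
      field_simp
  rw [hmp]
  constructor
  · intro t ht
    have ht0 : 0 < |t| := lt_of_lt_of_le (by positivity) ht
    obtain ⟨ha, hmul, hT⟩ := key t (abs_pos.1 ht0)
    rw [hmul]
    refine rpow_mul_rpow_le_mul_of_le_mul_rpow two_pos hp ha.le ht0 ?_
    have hma : m ≤ |finv t| := by
      by_contra! hlt
      have h1 := mul_lt_mul_of_pos_left (Real.rpow_lt_rpow ha.le hlt hr)
        (Real.rpow_pos_of_pos hm (p - r))
      have h2 := Real.rpow_lt_rpow ha.le hlt hp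
      linarith [hsplit m hm]
    have h1 := mul_le_mul_of_nonneg_right (Real.rpow_le_rpow hm.le hma hpr.le)
      (Real.rpow_nonneg ha.le r)
    linarith [hsplit _ ha]
  · intro t ht
    rcases eq_or_ne t 0 with rfl | ht0
    · have : (r + 1) / r ≠ 0 := by positivity
      simp [Real.zero_rpow this]
    obtain ⟨ha, hmul, hT⟩ := key t ht0
    rw [hmul]
    refine rpow_mul_rpow_le_mul_of_le_mul_rpow (by positivity) hr ha.le (abs_pos.2 ht0) ?_
    have hma : |finv t| ≤ m := by
      by_contra! hlt
      have h1 := mul_lt_mul_of_pos_left (Real.rpow_lt_rpow hm.le hlt hr)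
        (Real.rpow_pos_of_pos hm (p - r))
      have h2 := Real.rpow_lt_rpow hm.le hlt hp
      linarith [hsplit m hm]
    have h1 := mul_le_mul_of_nonneg_right (Real.rpow_le_rpow ha.le hma hpr.le)
      (Real.rpow_nonneg ha.le r)
    linarith [hsplit _ ha]
end
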